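/- Let H be a complex Hilbert space and T a bounded linear operator on H. Then ‖F(T)‖ ≤ 2 · ‖F‖_{W(T)} holds for every n ≥ 1 and every n×n matrix polynomial F if and only if w(F(T)) ≤ (5/4) · ‖F‖_{W(T)} holds for every n ≥ 1 and every n×n matrix polynomial F. -/

import Mathlib

open scoped InnerProductSpace
open ContinuousLinearMap Polynomial

noncomputable section

/-- The numerical radius `w(X) = sup { |⟨X x, x⟩| : ‖x‖ = 1 }` of a bounded operator
on a complex inner product space. (Here `⟪x, X x⟫_ℂ` is the mathematicians'
`⟨X x, x⟩`, since Mathlib's inner product is conjugate-linear in the first slot.) -/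
def numRadius {E : Type*} [NormedAddCommGroup E] [InnerProductSpace ℂ E]
    (X : E →L[ℂ] E) : ℝ :=
  sSup {r : ℝ | ∃ x : E, ‖x‖ = 1 ∧ r = ‖(⟪x, X x⟫_ℂ : ℂ)‖}

/-- The numerical range `W(X) = { ⟨X x, x⟩ : ‖x‖ = 1 }` of a bounded operator
on a complex inner product space. (Here `⟪x, X x⟫_ℂ` is the mathematicians'
`⟨X x, x⟩`, since Mathlib's inner product is conjugate-linear in the first slot.) -/
def numRange {E : Type*} [NormedAddCommGroup E] [InnerProductSpace ℂ E]
    (X : E →L[ℂ] E) : Set ℂ :=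
  {z : ℂ | ∃ x : E, ‖x‖ = 1 ∧ z = ⟪x, X x⟫_ℂ}

/-- The 2×2 block operator `[[A, B], [C, D]]` acting on the Hilbert space
direct sum `H ⊕₂ H`. -/
def blockOp {H : Type*} [NormedAddCommGroup H] [InnerProductSpace ℂ H]
    (A B C D : H →L[ℂ] H) : WithLp 2 (H × H) →L[ℂ] WithLp 2 (H × H) :=
  ((WithLp.prodContinuousLinearEquiv 2 ℂ H H).symm :
      (H × H) →L[ℂ] WithLp 2 (H × H)) ∘L
    ((A ∘L fst ℂ H H + B ∘L snd ℂ H H).prod (C ∘L fst ℂ H H + D ∘L snd ℂ H H)) ∘L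
    ((WithLp.prodContinuousLinearEquiv 2 ℂ H H) : WithLp 2 (H × H) →L[ℂ] (H × H))

/-- Evaluation of an `n × n` matrix polynomial `F = (p_{ij})` at an operator `T`:
the block operator `(p_{ij}(T))` acting on the `n`-fold Hilbert direct sum `Hⁿ`. -/
def matPolyEval {H : Type*} [NormedAddCommGroup H] [InnerProductSpace ℂ H]
    {n : ℕ} (T : H →L[ℂ] H)
    (F : Matrix (Fin n) (Fin n) (Polynomial ℂ)) :
    (PiLp 2 fun _ : Fin n => H) →L[ℂ] (PiLp 2 fun _ : Fin n => H) :=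
  ((PiLp.continuousLinearEquiv 2 ℂ fun _ : Fin n => H).symm :
      (Fin n → H) →L[ℂ] PiLp 2 fun _ : Fin n => H) ∘L
    (pi fun i => ∑ j, (aeval T (F i j)) ∘L proj j) ∘L
    ((PiLp.continuousLinearEquiv 2 ℂ fun _ : Fin n => H) :
      (PiLp 2 fun _ : Fin n => H) →L[ℂ] (Fin n → H))

/-- The supremum norm `‖F‖_K = sup_{z ∈ K} ‖F(z)‖` of an `n × n` matrix polynomial
over a set `K ⊆ ℂ`, where `‖F(z)‖` is the operator norm of the matrix `F(z)` on `ℂⁿ`. -/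
def matPolyNorm {n : ℕ} (K : Set ℂ) (F : Matrix (Fin n) (Fin n) (Polynomial ℂ)) : ℝ :=
  sSup {r : ℝ | ∃ z ∈ K, r = ‖Matrix.toEuclideanCLM (𝕜 := ℂ) (F.map (Polynomial.eval z))‖}

section Evaluation

variable {H : Type*} [NormedAddCommGroup H] [InnerProductSpace ℂ H]

lemma matPolyEval_apply {n : ℕ} (T : H →L[ℂ] H) (F : Matrix (Fin n) (Fin n) (Polynomial ℂ))
    (x : PiLp 2 fun _ : Fin n => H) (i : Fin n) :
    matPolyEval T F x i = ∑ j, aeval T (F i j) (x j) := by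
  simp [matPolyEval]

/-- Evaluation of matrix polynomials at a fixed operator is an algebra homomorphism. -/
def matPolyEvalAlgHom (n : ℕ) (T : H →L[ℂ] H) :
    Matrix (Fin n) (Fin n) (Polynomial ℂ) →ₐ[ℂ]
      ((PiLp 2 fun _ : Fin n => H) →L[ℂ] (PiLp 2 fun _ : Fin n => H)) :=
  AlgHom.ofLinearMap
    { toFun := matPolyEval T
      map_add' := fun F G => by
        ext x i
        simp [matPolyEval_apply, Finset.sum_add_distrib]
      map_smul' := fun c F => by
        ext x i
        simp [matPolyEval_apply, Finset.smul_sum] }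
    (by
      ext x i
      simp only [LinearMap.coe_mk, AddHom.coe_mk, matPolyEval_apply]
      rw [Finset.sum_eq_single i]
      · simp
      · intro j _ hj
        simp [Matrix.one_apply_ne hj.symm]
      · simp)
    (fun F G => by
      ext x i
      simp only [LinearMap.coe_mk, AddHom.coe_mk, matPolyEval_apply,
        mul_apply_eq_comp, Matrix.mul_apply, map_sum, map_mul,
        sum_apply]
      exact Finset.sum_comm)

@[simp]
lemma matPolyEvalAlgHom_apply {n : ℕ} (T : H →L[ℂ] H)
    (F : Matrix (Fin n) (Fin n) (Polynomial ℂ)) :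
    matPolyEvalAlgHom n T F = matPolyEval T F := rfl

/-- Evaluating at a scalar agrees with evaluating at the operator of multiplication by it. -/
lemma toEuclideanCLM_map_eval {n : ℕ} (F : Matrix (Fin n) (Fin n) (Polynomial ℂ)) (z : ℂ) :
    Matrix.toEuclideanCLM (𝕜 := ℂ) (F.map (Polynomial.eval z)) =
      matPolyEval (algebraMap ℂ (ℂ →L[ℂ] ℂ) z) F := by
  ext x i
  rw [matPolyEval_apply, Matrix.ofLp_toEuclideanCLM]
  simp only [aeval_algebraMap_apply]
  simp [Matrix.mulVec, dotProduct, Algebra.algebraMap_eq_smul_one]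

end Evaluation

section NormOnSet

lemma norm_matPolyEval_smul {H : Type*} [NormedAddCommGroup H] [InnerProductSpace ℂ H] {n : ℕ}
    (T : H →L[ℂ] H) (c : ℂ) (F : Matrix (Fin n) (Fin n) (Polynomial ℂ)) :
    ‖matPolyEval T (c • F)‖ = ‖c‖ * ‖matPolyEval T F‖ := by
  have hsmul (E : Type _) [NormedAddCommGroup E] [InnerProductSpace ℂ E] (X : E →L[ℂ] E) :
      ‖c • X‖ = ‖c‖ * ‖X‖ := norm_smul c X
  rw [← matPolyEvalAlgHom_apply, map_smul]
  exact hsmul _ _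

lemma norm_le_matPolyNorm {n : ℕ} {K : Set ℂ} (hK : Bornology.IsBounded K)
    (F : Matrix (Fin n) (Fin n) (Polynomial ℂ)) {z : ℂ} (hz : z ∈ K) :
    ‖matPolyEval (algebraMap ℂ (ℂ →L[ℂ] ℂ) z) F‖ ≤ matPolyNorm K F := by
  rw [← toEuclideanCLM_map_eval]
  refine le_csSup ?_ ⟨z, hz, rfl⟩
  have hcont : Continuous fun z : ℂ =>
      ‖Matrix.toEuclideanCLM (n := Fin n) (𝕜 := ℂ) (F.map (Polynomial.eval z))‖ := by
    have h1 : Continuous fun M : Matrix (Fin n) (Fin n) ℂ =>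
        Matrix.toEuclideanCLM (n := Fin n) (𝕜 := ℂ) M :=
      LinearMap.continuous_of_finiteDimensional
        (Matrix.toEuclideanCLM (n := Fin n) (𝕜 := ℂ)).toAlgEquiv.toLinearMap
    have h2 : Continuous fun z : ℂ => F.map (Polynomial.eval z) :=
      continuous_matrix fun i j => (F i j).continuous
    exact (h1.comp h2).norm
  obtain ⟨b, hb⟩ := hK.isCompact_closure.bddAbove_image hcont.continuousOn
  refine ⟨b, ?_⟩
  rintro r ⟨w, hw, rfl⟩
  exact hb ⟨w, subset_closure hw, rfl⟩

lemma matPolyNorm_le {n : ℕ} {K : Set ℂ} {F : Matrix (Fin n) (Fin n) (Polynomial ℂ)} {c : ℝ}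
    (hc : 0 ≤ c) (h : ∀ z ∈ K, ‖matPolyEval (algebraMap ℂ (ℂ →L[ℂ] ℂ) z) F‖ ≤ c) :
    matPolyNorm K F ≤ c := by
  refine Real.sSup_le ?_ hc
  rintro r ⟨z, hz, rfl⟩
  rw [toEuclideanCLM_map_eval]
  exact h z hz

lemma matPolyNorm_nonneg {n : ℕ} (K : Set ℂ) (F : Matrix (Fin n) (Fin n) (Polynomial ℂ)) :
    0 ≤ matPolyNorm K F := by
  refine Real.sSup_nonneg ?_
  rintro r ⟨z, -, rfl⟩
  exact norm_nonneg _

/-- A matrix polynomial can be normalised by any constant exceeding its norm on `K`. -/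
lemma norm_matPolyEval_inv_smul_le_one {n : ℕ} {K : Set ℂ} (hK : Bornology.IsBounded K)
    (F : Matrix (Fin n) (Fin n) (Polynomial ℂ)) {r : ℝ} (hr : matPolyNorm K F < r) {z : ℂ}
    (hz : z ∈ K) :
    ‖matPolyEval (algebraMap ℂ (ℂ →L[ℂ] ℂ) z) ((r : ℂ)⁻¹ • F)‖ ≤ 1 := by
  have hr0 : 0 < r := (matPolyNorm_nonneg K F).trans_lt hr
  rw [norm_matPolyEval_smul, norm_inv, Complex.norm_real, Real.norm_of_nonneg hr0.le,
    inv_mul_le_one₀ hr0]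
  exact (norm_le_matPolyNorm hK F hz).trans hr.le

end NormOnSet

section NumericalRadius

variable {E : Type*} [NormedAddCommGroup E] [InnerProductSpace ℂ E]

lemma norm_inner_apply_le (X : E →L[ℂ] E) {x : E} (hx : ‖x‖ = 1) : ‖⟪x, X x⟫_ℂ‖ ≤ ‖X‖ := by
  simpa [hx] using (norm_inner_le_norm (𝕜 := ℂ) x (X x)).trans
    (mul_le_mul_of_nonneg_left (X.le_opNorm x) (norm_nonneg x))

lemma isBounded_numRange (X : E →L[ℂ] E) : Bornology.IsBounded (numRange X) := by
  refine isBounded_iff_forall_norm_le.2 ⟨‖X‖, ?_⟩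
  rintro z ⟨x, hx, rfl⟩
  exact norm_inner_apply_le X hx

lemma norm_inner_apply_le_numRadius (X : E →L[ℂ] E) {x : E} (hx : ‖x‖ = 1) :
    ‖⟪x, X x⟫_ℂ‖ ≤ numRadius X := by
  refine le_csSup ⟨‖X‖, ?_⟩ ⟨x, hx, rfl⟩
  rintro r ⟨y, hy, rfl⟩
  exact norm_inner_apply_le X hy

lemma numRadius_le {X : E →L[ℂ] E} {c : ℝ} (hc : 0 ≤ c)
    (h : ∀ x : E, ‖x‖ = 1 → ‖⟪x, X x⟫_ℂ‖ ≤ c) : numRadius X ≤ c := by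
  refine Real.sSup_le ?_ hc
  rintro r ⟨x, hx, rfl⟩
  exact h x hx

lemma norm_inner_apply_le_numRadius_mul (X : E →L[ℂ] E) (x : E) :
    ‖⟪x, X x⟫_ℂ‖ ≤ numRadius X * ‖x‖ ^ 2 := by
  rcases eq_or_ne x 0 with rfl | hx
  · simp
  have hx' : ‖x‖ ≠ 0 := norm_ne_zero_iff.2 hx
  have hunit : ‖(‖x‖ : ℂ)⁻¹ • x‖ = 1 := by
    rw [norm_smul, norm_inv, Complex.norm_real, norm_norm, inv_mul_cancel₀ hx']
  have h := norm_inner_apply_le_numRadius X hunit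
  rw [map_smul, inner_smul_left, inner_smul_right, norm_mul, norm_mul, RCLike.norm_conj,
    norm_inv, Complex.norm_real, norm_norm] at h
  calc ‖⟪x, X x⟫_ℂ‖ = ‖x‖⁻¹ * (‖x‖⁻¹ * ‖⟪x, X x⟫_ℂ‖) * ‖x‖ ^ 2 := by field_simp
    _ ≤ numRadius X * ‖x‖ ^ 2 := by gcongr

end NumericalRadius

section Moebius

variable {E : Type*} [NormedAddCommGroup E] [InnerProductSpace ℂ E]

lemma norm_sub_half_smul_sq (u v : E) :
    ‖u - (1 / 2 : ℂ) • v‖ ^ 2 = ‖u‖ ^ 2 - (⟪v, u⟫_ℂ).re + ‖v‖ ^ 2 / 4 := by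
  have hre : (⟪v, u⟫_ℂ).re = (⟪u, v⟫_ℂ).re := by rw [← inner_conj_symm, Complex.conj_re]
  rw [norm_sub_sq (𝕜 := ℂ), inner_smul_right, norm_smul, hre]
  simp
  ring

/-- The truncated Neumann series of the Möbius transform `(b - 1/2) / (1 - b/2)`. -/
def truncatedMoebius {A : Type*} [Ring A] [Algebra ℂ A] (b : A) (N : ℕ) : A :=
  (b - (1 / 2 : ℂ) • 1) * ∑ k ∈ Finset.range N, ((1 / 2 : ℂ) • b) ^ k

lemma map_truncatedMoebius {A B : Type*} [Ring A] [Algebra ℂ A] [Ring B] [Algebra ℂ B]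
    (φ : A →ₐ[ℂ] B) (b : A) (N : ℕ) :
    φ (truncatedMoebius b N) = truncatedMoebius (φ b) N := by
  simp [truncatedMoebius, map_sum, map_pow]

lemma truncatedMoebius_mul {A : Type*} [Ring A] [Algebra ℂ A] (b : A) (N : ℕ) :
    truncatedMoebius b N * (1 - (1 / 2 : ℂ) • b) =
      (b - (1 / 2 : ℂ) • 1) * (1 - ((1 / 2 : ℂ) • b) ^ N) := by
  rw [truncatedMoebius, mul_assoc, geom_sum_mul_neg]

lemma norm_pow_le_one {B : E →L[ℂ] E} (hB : ‖B‖ ≤ 1) (N : ℕ) : ‖B ^ N‖ ≤ 1 := by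
  rcases N.eq_zero_or_pos with rfl | hN
  · exact ContinuousLinearMap.norm_id_le
  · exact (norm_pow_le' B hN).trans (pow_le_one₀ (norm_nonneg _) hB)

lemma norm_truncatedMoebius_le {B : E →L[ℂ] E} (hB : ‖B‖ ≤ 1) (N : ℕ) :
    ‖truncatedMoebius B N‖ ≤ 1 + (1 / 2) ^ N := by
  refine ContinuousLinearMap.opNorm_le_bound _ (by positivity) fun x => ?_
  set S : E →L[ℂ] E := ∑ k ∈ Finset.range N, ((1 / 2 : ℂ) • B) ^ k with hS
  have hle : ‖B (S x) - (1 / 2 : ℂ) • S x‖ ≤ ‖S x - (1 / 2 : ℂ) • B (S x)‖ := by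
    refine (sq_le_sq₀ (norm_nonneg _) (norm_nonneg _)).1 ?_
    have hBS : ‖B (S x)‖ ≤ ‖S x‖ := by
      simpa using B.le_of_opNorm_le hB (S x)
    have hsq : ‖B (S x)‖ ^ 2 ≤ ‖S x‖ ^ 2 := by gcongr
    rw [norm_sub_half_smul_sq, norm_sub_half_smul_sq, ← inner_conj_symm (S x), Complex.conj_re]
    linarith
  have hgeom : S x - (1 / 2 : ℂ) • B (S x) = x - (((1 / 2 : ℂ) • B) ^ N) x := by
    exact DFunLike.congr_fun (mul_neg_geom_sum ((1 / 2 : ℂ) • B) N) x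
  have hpow : ‖(((1 / 2 : ℂ) • B) ^ N) x‖ ≤ (1 / 2) ^ N * ‖x‖ := by
    refine ContinuousLinearMap.le_of_opNorm_le _ ?_ x
    rw [_root_.smul_pow, norm_smul, norm_pow]
    simpa using mul_le_mul_of_nonneg_left (norm_pow_le_one hB N)
      (by positivity : (0 : ℝ) ≤ ‖(1 / 2 : ℂ)‖ ^ N)
  calc ‖truncatedMoebius B N x‖ = ‖B (S x) - (1 / 2 : ℂ) • S x‖ := by
        rfl
    _ ≤ ‖x - (((1 / 2 : ℂ) • B) ^ N) x‖ := hgeom ▸ hle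
    _ ≤ ‖x‖ + (1 / 2) ^ N * ‖x‖ := (norm_sub_le _ _).trans (by gcongr)
    _ = (1 + (1 / 2) ^ N) * ‖x‖ := by ring

/-- If the Möbius transform `(A - 1/2) (1 - A/2)⁻¹` has norm at most `2`, then
`Re ⟨A x, x⟩ ≤ 5/4` for every unit vector `x`. -/
lemma re_inner_apply_le_of_norm_le {A : E →L[ℂ] E} {x : E} (hx : ‖x‖ = 1)
    (h : ‖A x - (1 / 2 : ℂ) • x‖ ≤ 2 * ‖x - (1 / 2 : ℂ) • A x‖) :
    (⟪x, A x⟫_ℂ).re ≤ 5 / 4 := by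
  have hsq : ‖A x - (1 / 2 : ℂ) • x‖ ^ 2 ≤ (2 * ‖x - (1 / 2 : ℂ) • A x‖) ^ 2 := by gcongr
  rw [mul_pow, norm_sub_half_smul_sq, norm_sub_half_smul_sq, ← inner_conj_symm x,
    Complex.conj_re, hx] at hsq
  rw [← inner_conj_symm x, Complex.conj_re]
  linarith

lemma re_inner_apply_le_of_norm_truncatedMoebius_le {A : E →L[ℂ] E}
    (hmoeb : ∀ N : ℕ, ‖truncatedMoebius A N‖ ≤ 2 * (1 + (1 / 2) ^ N))
    (hpow : ∀ N : ℕ, ‖A ^ N‖ ≤ 2) {x : E} (hx : ‖x‖ = 1) :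
    (⟪x, A x⟫_ℂ).re ≤ 5 / 4 := by
  have hhalf : Filter.Tendsto (fun N : ℕ => (1 / 2 : ℝ) ^ N) Filter.atTop (nhds 0) :=
    tendsto_pow_atTop_nhds_zero_of_lt_one (by norm_num) (by norm_num)
  have hzero : Filter.Tendsto (fun N : ℕ => (((1 / 2 : ℂ) • A) ^ N)) Filter.atTop (nhds 0) := by
    refine squeeze_zero_norm (a := fun N : ℕ => (1 / 2 : ℝ) ^ N * 2) (fun N => ?_) ?_
    · rw [_root_.smul_pow, norm_smul, norm_pow]
      simpa using mul_le_mul_of_nonneg_left (hpow N) (by positivity : (0 : ℝ) ≤ ‖(1 / 2 : ℂ)‖ ^ N)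
    · simpa using hhalf.mul_const 2
  refine re_inner_apply_le_of_norm_le hx ?_
  have hbound (N : ℕ) : ‖((A - (1 / 2 : ℂ) • 1) * (1 - ((1 / 2 : ℂ) • A) ^ N)) x‖ ≤
      2 * (1 + (1 / 2) ^ N) * ‖x - (1 / 2 : ℂ) • A x‖ := by
    rw [← truncatedMoebius_mul]
    simpa using (truncatedMoebius A N).le_of_opNorm_le (hmoeb N) (x - (1 / 2 : ℂ) • A x)
  have hleft : Filter.Tendsto
      (fun N : ℕ => ‖((A - (1 / 2 : ℂ) • 1) * (1 - ((1 / 2 : ℂ) • A) ^ N)) x‖)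
      Filter.atTop (nhds ‖A x - (1 / 2 : ℂ) • x‖) := by
    have h1 := ((ContinuousLinearMap.apply ℂ E x).continuous.tendsto _).comp
      (((tendsto_const_nhds (x := (1 : E →L[ℂ] E))).sub hzero).const_mul (A - (1 / 2 : ℂ) • 1))
    have h2 : (ContinuousLinearMap.apply ℂ E x) ((A - (1 / 2 : ℂ) • 1) * (1 - 0)) =
        A x - (1 / 2 : ℂ) • x := by
      simp
    exact (h2 ▸ h1).norm
  have hright : Filter.Tendsto
      (fun N : ℕ => 2 * (1 + (1 / 2 : ℝ) ^ N) * ‖x - (1 / 2 : ℂ) • A x‖)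
      Filter.atTop (nhds (2 * ‖x - (1 / 2 : ℂ) • A x‖)) := by
    simpa using ((hhalf.const_add 1).const_mul 2).mul_const ‖x - (1 / 2 : ℂ) • A x‖
  exact le_of_tendsto_of_tendsto' hleft hright hbound

end Moebius

section Forward

variable {H : Type*} [NormedAddCommGroup H] [InnerProductSpace ℂ H]

lemma re_inner_matPolyEval_le {n : ℕ} {K : Set ℂ} (T : H →L[ℂ] H)
    (h : ∀ F : Matrix (Fin n) (Fin n) (Polynomial ℂ), ‖matPolyEval T F‖ ≤ 2 * matPolyNorm K F)
    {F : Matrix (Fin n) (Fin n) (Polynomial ℂ)}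
    (hF : ∀ z ∈ K, ‖matPolyEval (algebraMap ℂ (ℂ →L[ℂ] ℂ) z) F‖ ≤ 1)
    {x : PiLp 2 fun _ : Fin n => H} (hx : ‖x‖ = 1) :
    (⟪x, matPolyEval T F x⟫_ℂ).re ≤ 5 / 4 := by
  have hmoeb (N : ℕ) : ‖truncatedMoebius (matPolyEval T F) N‖ ≤ 2 * (1 + (1 / 2) ^ N) := by
    have h1 := h (truncatedMoebius F N)
    rw [← matPolyEvalAlgHom_apply, map_truncatedMoebius] at h1
    refine h1.trans (mul_le_mul_of_nonneg_left (matPolyNorm_le (by positivity) fun z hz => ?_)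
      zero_le_two)
    rw [← matPolyEvalAlgHom_apply, map_truncatedMoebius]
    exact norm_truncatedMoebius_le (hF z hz) N
  have hpow (N : ℕ) : ‖matPolyEval T F ^ N‖ ≤ 2 := by
    have h1 := h (F ^ N)
    rw [← matPolyEvalAlgHom_apply, map_pow] at h1
    refine h1.trans ?_
    have : matPolyNorm K (F ^ N) ≤ 1 := matPolyNorm_le zero_le_one fun z hz => by
      rw [← matPolyEvalAlgHom_apply, map_pow]
      exact norm_pow_le_one (hF z hz) N
    linarith
  exact re_inner_apply_le_of_norm_truncatedMoebius_le hmoeb hpow hx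

lemma numRadius_matPolyEval_le {n : ℕ} {K : Set ℂ} (hK : Bornology.IsBounded K) (T : H →L[ℂ] H)
    (h : ∀ F : Matrix (Fin n) (Fin n) (Polynomial ℂ), ‖matPolyEval T F‖ ≤ 2 * matPolyNorm K F)
    (F : Matrix (Fin n) (Fin n) (Polynomial ℂ)) :
    numRadius (matPolyEval T F) ≤ 5 / 4 * matPolyNorm K F := by
  refine numRadius_le (mul_nonneg (by norm_num) (matPolyNorm_nonneg K F)) fun x hx => ?_
  rw [← div_le_iff₀' (by norm_num)]
  refine le_of_forall_gt_imp_ge_of_dense fun r hr => ?_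
  have hr0 : 0 < r := (matPolyNorm_nonneg K F).trans_lt hr
  obtain ⟨c, hc, hcx⟩ := RCLike.exists_norm_eq_mul_self (K := ℂ) ⟪x, matPolyEval T F x⟫_ℂ
  have hbound : (⟪x, matPolyEval T (c • (r : ℂ)⁻¹ • F) x⟫_ℂ).re ≤ 5 / 4 := by
    refine re_inner_matPolyEval_le T h (fun z hz => ?_) hx
    rw [norm_matPolyEval_smul, hc, one_mul]
    exact norm_matPolyEval_inv_smul_le_one hK F hr hz
  have hval : ⟪x, matPolyEval T (c • (r : ℂ)⁻¹ • F) x⟫_ℂ =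
      ((r⁻¹ * ‖⟪x, matPolyEval T F x⟫_ℂ‖ : ℝ) : ℂ) := by
    rw [← matPolyEvalAlgHom_apply, map_smul, map_smul, smul_comm, matPolyEvalAlgHom_apply,
      smul_apply, smul_apply, inner_smul_right, inner_smul_right, Complex.ofReal_mul,
      Complex.ofReal_inv]
    exact congrArg _ hcx.symm
  rw [hval, Complex.ofReal_re, inv_mul_le_iff₀ hr0] at hbound
  linarith

end Forward

section Converse

variable {n : ℕ}

/-- The identification of `Hⁿ ⊕ Hⁿ` with `H²ⁿ`, as a map of two variables. -/
def piLpAppend {H : Type*} (u v : PiLp 2 fun _ : Fin n => H) : PiLp 2 fun _ : Fin (n + n) => H :=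
  WithLp.toLp 2 (Fin.append u.ofLp v.ofLp)

lemma exists_eq_piLpAppend {H : Type*} (w : PiLp 2 fun _ : Fin (n + n) => H) :
    ∃ u v : PiLp 2 fun _ : Fin n => H, w = piLpAppend u v := by
  refine ⟨WithLp.toLp 2 fun i => w (Fin.castAdd n i), WithLp.toLp 2 fun i => w (Fin.natAdd n i), ?_⟩
  ext i
  refine Fin.addCases (fun i => ?_) (fun i => ?_) i <;>
    simp [piLpAppend, -Fin.natAdd_eq_addNat]

lemma norm_piLpAppend_sq {H : Type*} [NormedAddCommGroup H] (u v : PiLp 2 fun _ : Fin n => H) :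
    ‖piLpAppend u v‖ ^ 2 = ‖u‖ ^ 2 + ‖v‖ ^ 2 := by
  simp [PiLp.norm_sq_eq_of_L2, Fin.sum_univ_add, piLpAppend, -Fin.natAdd_eq_addNat]

variable {H : Type*} [NormedAddCommGroup H] [InnerProductSpace ℂ H]

lemma inner_piLpAppend (u v u' v' : PiLp 2 fun _ : Fin n => H) :
    ⟪piLpAppend u v, piLpAppend u' v'⟫_ℂ = ⟪u, u'⟫_ℂ + ⟪v, v'⟫_ℂ := by
  simp [PiLp.inner_apply, Fin.sum_univ_add, piLpAppend, -Fin.natAdd_eq_addNat]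

lemma matPolyEval_fromBlocks (T : H →L[ℂ] H) (A B C D : Matrix (Fin n) (Fin n) (Polynomial ℂ))
    (u v : PiLp 2 fun _ : Fin n => H) :
    matPolyEval T (Matrix.reindex finSumFinEquiv finSumFinEquiv (Matrix.fromBlocks A B C D))
        (piLpAppend u v) =
      piLpAppend (matPolyEval T A u + matPolyEval T B v)
        (matPolyEval T C u + matPolyEval T D v) := by
  ext i
  refine Fin.addCases (fun i => ?_) (fun i => ?_) i <;>
    simp [matPolyEval_apply, Fin.sum_univ_add, piLpAppend, -Fin.natAdd_eq_addNat]

/-- The matrix polynomial `[[1/2, 0], [3/4 F, 1/2]]`. -/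
def lowerTriangularDilation (F : Matrix (Fin n) (Fin n) (Polynomial ℂ)) :
    Matrix (Fin (n + n)) (Fin (n + n)) (Polynomial ℂ) :=
  Matrix.reindex finSumFinEquiv finSumFinEquiv
    (Matrix.fromBlocks ((1 / 2 : ℂ) • 1) 0 ((3 / 4 : ℂ) • F) ((1 / 2 : ℂ) • 1))

lemma matPolyEval_lowerTriangularDilation (T : H →L[ℂ] H)
    (F : Matrix (Fin n) (Fin n) (Polynomial ℂ)) (u v : PiLp 2 fun _ : Fin n => H) :
    matPolyEval T (lowerTriangularDilation F) (piLpAppend u v) =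
      piLpAppend ((1 / 2 : ℂ) • u) ((3 / 4 : ℂ) • matPolyEval T F u + (1 / 2 : ℂ) • v) := by
  rw [lowerTriangularDilation, matPolyEval_fromBlocks]
  simp only [← matPolyEvalAlgHom_apply, map_smul, map_one, map_zero]
  simp

lemma norm_matPolyEval_lowerTriangularDilation_le {T : H →L[ℂ] H}
    {F : Matrix (Fin n) (Fin n) (Polynomial ℂ)} (hF : ‖matPolyEval T F‖ ≤ 1) :
    ‖matPolyEval T (lowerTriangularDilation F)‖ ≤ 1 := by
  refine ContinuousLinearMap.opNorm_le_bound _ zero_le_one fun w => ?_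
  obtain ⟨u, v, rfl⟩ := exists_eq_piLpAppend w
  rw [one_mul, matPolyEval_lowerTriangularDilation]
  refine (sq_le_sq₀ (norm_nonneg _) (norm_nonneg _)).1 ?_
  rw [norm_piLpAppend_sq, norm_piLpAppend_sq]
  have hFu : ‖matPolyEval T F u‖ ≤ ‖u‖ := by
    simpa using (matPolyEval T F).le_of_opNorm_le hF u
  have h1 : ‖(1 / 2 : ℂ) • u‖ = 1 / 2 * ‖u‖ := by simp [norm_smul]
  have h2 : ‖(3 / 4 : ℂ) • matPolyEval T F u + (1 / 2 : ℂ) • v‖ ≤ 3 / 4 * ‖u‖ + 1 / 2 * ‖v‖ := by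
    refine (norm_add_le _ _).trans ?_
    rw [norm_smul, norm_smul]
    norm_num
    linarith
  have h3 : ‖(3 / 4 : ℂ) • matPolyEval T F u + (1 / 2 : ℂ) • v‖ ^ 2 ≤
      (3 / 4 * ‖u‖ + 1 / 2 * ‖v‖) ^ 2 := by gcongr
  rw [h1]
  nlinarith [sq_nonneg (‖u‖ - 2 * ‖v‖)]

lemma norm_le_two_of_numRadius_lowerTriangularDilation_le {T : H →L[ℂ] H}
    {F : Matrix (Fin n) (Fin n) (Polynomial ℂ)}
    (h : numRadius (matPolyEval T (lowerTriangularDilation F)) ≤ 5 / 4) :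
    ‖matPolyEval T F‖ ≤ 2 := by
  refine ContinuousLinearMap.opNorm_le_bound _ zero_le_two fun u => ?_
  set y := matPolyEval T F u with hy
  rcases eq_or_ne y 0 with h0 | h0
  · rw [h0, norm_zero]
    positivity
  have hy0 : 0 < ‖y‖ := norm_pos_iff.2 h0
  set v := ((‖u‖ / ‖y‖ : ℝ) : ℂ) • y with hv
  have hvn : ‖v‖ = ‖u‖ := by
    rw [hv, norm_smul, Complex.norm_real, Real.norm_of_nonneg (by positivity)]
    field_simp
  have key := (Complex.re_le_norm _).trans ((norm_inner_apply_le_numRadius_mul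
    (matPolyEval T (lowerTriangularDilation F)) (piLpAppend u v)).trans
    (mul_le_mul_of_nonneg_right h (sq_nonneg _)))
  have hvy : ⟪v, y⟫_ℂ = ((‖u‖ * ‖y‖ : ℝ) : ℂ) := by
    rw [hv, inner_smul_left, Complex.conj_ofReal, inner_self_eq_norm_sq_to_K]
    simp
    field_simp
  rw [matPolyEval_lowerTriangularDilation, ← hy, inner_piLpAppend, norm_piLpAppend_sq,
    inner_add_right, inner_smul_right, inner_smul_right, inner_smul_right, hvy,
    inner_self_eq_norm_sq_to_K, inner_self_eq_norm_sq_to_K, hvn] at key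
  have hu0 : 0 < ‖u‖ := norm_pos_iff.2 fun hu => h0 (by rw [hy, hu, map_zero])
  have hre : 1 / 2 * ‖u‖ ^ 2 + (3 / 4 * (‖u‖ * ‖y‖) + 1 / 2 * ‖u‖ ^ 2) ≤
      5 / 4 * (‖u‖ ^ 2 + ‖u‖ ^ 2) := by
    have hcast : ((1 / 2 * ‖u‖ ^ 2 + (3 / 4 * (‖u‖ * ‖y‖) + 1 / 2 * ‖u‖ ^ 2) : ℝ) : ℂ) =
        1 / 2 * (‖u‖ : ℂ) ^ 2 +
          (3 / 4 * ((‖u‖ * ‖y‖ : ℝ) : ℂ) + 1 / 2 * (‖u‖ : ℂ) ^ 2) := by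
      push_cast
      rfl
    exact (congrArg Complex.re hcast).trans_le key
  refine le_of_mul_le_mul_left ?_ hu0
  linarith

lemma norm_matPolyEval_le {K : Set ℂ} (hK : Bornology.IsBounded K) (T : H →L[ℂ] H)
    (h : ∀ F : Matrix (Fin (n + n)) (Fin (n + n)) (Polynomial ℂ),
      numRadius (matPolyEval T F) ≤ 5 / 4 * matPolyNorm K F)
    (F : Matrix (Fin n) (Fin n) (Polynomial ℂ)) :
    ‖matPolyEval T F‖ ≤ 2 * matPolyNorm K F := by
  rw [← div_le_iff₀' zero_lt_two]
  refine le_of_forall_gt_imp_ge_of_dense fun r hr => ?_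
  have hr0 : 0 < r := (matPolyNorm_nonneg K F).trans_lt hr
  have hle : ‖matPolyEval T ((r : ℂ)⁻¹ • F)‖ ≤ 2 := by
    refine norm_le_two_of_numRadius_lowerTriangularDilation_le ((h _).trans ?_)
    have : matPolyNorm K (lowerTriangularDilation ((r : ℂ)⁻¹ • F)) ≤ 1 :=
      matPolyNorm_le zero_le_one fun z hz => norm_matPolyEval_lowerTriangularDilation_le
        (norm_matPolyEval_inv_smul_le_one hK F hr hz)
    linarith
  rw [norm_matPolyEval_smul, norm_inv, Complex.norm_real, Real.norm_of_nonneg hr0.le,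
    inv_mul_le_iff₀ hr0] at hle
  linarith

end Converse

/-- `W(T)` is a complete `2`-spectral set for `T` if and only if
`w(F(T)) ≤ (5/4)·‖F‖_{W(T)}` for every matrix polynomial `F`. -/
theorem numRange_complete_two_spectral_iff {H : Type*} [NormedAddCommGroup H]
    [InnerProductSpace ℂ H] [CompleteSpace H] (T : H →L[ℂ] H) :
    (∀ n : ℕ, 1 ≤ n → ∀ F : Matrix (Fin n) (Fin n) (Polynomial ℂ),
      ‖matPolyEval T F‖ ≤ 2 * matPolyNorm (numRange T) F) ↔
    (∀ n : ℕ, 1 ≤ n → ∀ F : Matrix (Fin n) (Fin n) (Polynomial ℂ),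
      numRadius (matPolyEval T F) ≤ (5 / 4) * matPolyNorm (numRange T) F) := by
  have hK := isBounded_numRange T
  exact ⟨fun h n hn => numRadius_matPolyEval_le hK T (h n hn),
    fun h n hn => norm_matPolyEval_le hK T (h (n + n) (by omega))⟩

end
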